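/- arXiv:math/9903108 — 3 statements merged into one kernel-verified Lean document; each statement's English description precedes it below -/
import Mathlib

section
/- Let R be a commutative ring, I ⊆ R an ideal, and d, N natural numbers with 4d ≤ N. Let M be an N×N matrix over R such that for every e ∈ {1, …, d}: (i) the entries of rows 2e−1 and 2e vanish in every column outside the set {4e−3, 4e−2, 4e−1, 4e}; and (ii) every 2×2 minor of the 2×4 submatrix of M with rows {2e−1, 2e} and columns {4e−3, 4e−2, 4e−1, 4e} lies in I (that is, M(2e−1,c)·M(2e,c′) − M(2e−1,c′)·M(2e,c) ∈ I for all c, c′ ∈ {4e−3, …, 4e}). Then det M ∈ I^d (the d-th power of the ideal I). -/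
open Matrix in
/-- Expansion of the determinant, by linearity, along a replaced row. -/
theorem Matrix.det_updateRow_eq_sum_single {n R : Type*} [Fintype n] [DecidableEq n] [CommRing R]
    (A : Matrix n n R) (k : n) (v : n → R) :
    (A.updateRow k v).det = ∑ i, v i * (A.updateRow k (Pi.single i 1)).det := by
  simp only [← cramer_transpose_apply]
  conv_lhs => rw [pi_eq_sum_univ' v]
  simp [Pi.single]

/-- Exchanging the values of two replaced rows changes the sign of the determinant. -/
theorem Matrix.det_updateRow_updateRow_swap {n R : Type*} [Fintype n] [DecidableEq n]
    [CommRing R] (A : Matrix n n R) {p q : n} (hpq : p ≠ q) (u v : n → R) :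
    ((A.updateRow p u).updateRow q v).det = -((A.updateRow p v).updateRow q u).det := by
  have h := Matrix.det_permute (Equiv.swap p q) ((A.updateRow p v).updateRow q u)
  rw [Equiv.Perm.sign_swap hpq] at h
  have h' : ((A.updateRow p v).updateRow q u).submatrix (Equiv.swap p q) id =
      (A.updateRow p u).updateRow q v := by
    ext i j
    simp only [Matrix.submatrix_apply, Matrix.updateRow_apply, Equiv.swap_apply_def, id]
    split_ifs <;> simp_all
  rw [← h', h]
  simp

/-- A double sum whose diagonal terms and symmetrized terms lie in an additive submonoid
lies in it. -/
theorem AddSubmonoid.sum_sum_mem_of_add_swap_mem {ι A : Type*} [AddCommMonoid A]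
    (J : AddSubmonoid A) (s : Finset ι) (x : ι → ι → A) (hdiag : ∀ i, x i i ∈ J)
    (hswap : ∀ i j, x i j + x j i ∈ J) : ∑ i ∈ s, ∑ j ∈ s, x i j ∈ J := by
  classical
  induction s using Finset.induction_on with
  | empty => simp
  | insert a s ha ih =>
    have h : ∑ i ∈ insert a s, ∑ j ∈ insert a s, x i j =
        x a a + ∑ j ∈ s, (x a j + x j a) + ∑ i ∈ s, ∑ j ∈ s, x i j := by
      simp only [Finset.sum_insert ha, Finset.sum_add_distrib]
      abel
    rw [h]
    exact add_mem (add_mem (hdiag a) (_root_.sum_mem fun j _ => hswap a j)) ih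

/-- If all `2 × 2` minors of two rows of `M` lie in `I`, and every matrix obtained from `M` by
replacing these rows has determinant in `J`, then `det M ∈ I * J`. -/
theorem Matrix.det_mem_mul_of_minors_mem {n R : Type*} [Fintype n] [DecidableEq n] [CommRing R]
    {I J : Ideal R} {M : Matrix n n R} {p q : n} (hpq : p ≠ q)
    (hI : ∀ c c', M p c * M q c' - M p c' * M q c ∈ I)
    (hJ : ∀ u v, ((M.updateRow p u).updateRow q v).det ∈ J) : M.det ∈ I * J := by
  set D : n → n → R := fun i j =>
    ((M.updateRow p (Pi.single i 1)).updateRow q (Pi.single j 1)).det with hD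
  have hdet : M.det = ∑ i, ∑ j, M p i * M q j * D i j := by
    conv_lhs => rw [← M.updateRow_eq_self p, Matrix.det_updateRow_eq_sum_single]
    refine Finset.sum_congr rfl fun i _ => ?_
    conv_lhs => rw [← (M.updateRow p (Pi.single i 1)).updateRow_eq_self q,
      Matrix.det_updateRow_eq_sum_single, Finset.mul_sum]
    simp [hD, Matrix.updateRow_ne hpq.symm, mul_assoc]
  rw [hdet]
  refine (I * J).toAddSubmonoid.sum_sum_mem_of_add_swap_mem _ _ (fun i => ?_) fun i j => ?_
  · have h : D i i = 0 := Matrix.det_zero_of_row_eq hpq (by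
      rw [Matrix.updateRow_ne hpq, Matrix.updateRow_self, Matrix.updateRow_self])
    simp [h]
  · have h : M p i * M q j * D i j + M p j * M q i * D j i =
        (M p i * M q j - M p j * M q i) * D i j := by
      rw [show D j i = -D i j from M.det_updateRow_updateRow_swap hpq _ _]
      ring
    rw [h]
    exact Ideal.mul_mem_mul (hI i j) (hJ _ _)

/-- If `M` has disjoint pairs of rows, indexed by `s`, such that all `2 × 2` minors of each pair
lie in `I`, then `det M ∈ I ^ #s`. -/
theorem Matrix.det_mem_pow_card_of_minors_mem {ι n R : Type*} [Fintype n] [DecidableEq n]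
    [CommRing R] {I : Ideal R} {p q : ι → n} (hp : p.Injective) (hq : q.Injective)
    (hpq : ∀ e e', p e ≠ q e') (s : Finset ι) {M : Matrix n n R}
    (hI : ∀ e ∈ s, ∀ c c', M (p e) c * M (q e) c' - M (p e) c' * M (q e) c ∈ I) :
    M.det ∈ I ^ s.card := by
  classical
  induction s using Finset.induction_on generalizing M with
  | empty => simp
  | insert a s ha ih =>
    rw [Finset.card_insert_of_notMem ha, pow_succ']
    refine Matrix.det_mem_mul_of_minors_mem (hpq a a) (hI a (Finset.mem_insert_self a s))
      fun u v => ih fun e he c c' => ?_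
    have hea : e ≠ a := fun h => ha (h ▸ he)
    simpa [Matrix.updateRow_apply, hp.ne hea, hq.ne hea, hpq, (hpq _ _).symm] using
      hI e (Finset.mem_insert_of_mem he) c c'


/-- If for each `e ∈ {1, …, d}` the rows `2e-1` and `2e` of `M` (1-indexed) are supported
on the columns `{4e-3, …, 4e}` and every `2 × 2` minor of the corresponding `2 × 4` block
lies in the ideal `I`, then `det M ∈ I ^ d`. -/
theorem det_mem_ideal_pow_of_blocks
    {R : Type*} [CommRing R] (I : Ideal R) (d N : ℕ) (hdN : 4 * d ≤ N)
    (M : Matrix (Fin N) (Fin N) R)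
    (hsupp : ∀ e : ℕ, (he1 : 1 ≤ e) → (he : e ≤ d) → ∀ j : Fin N,
      ((j : ℕ) < 4 * e - 4 ∨ 4 * e - 1 < (j : ℕ)) →
      M ⟨2 * e - 2, by omega⟩ j = 0 ∧ M ⟨2 * e - 1, by omega⟩ j = 0)
    (hminor : ∀ e : ℕ, (he1 : 1 ≤ e) → (he : e ≤ d) → ∀ c c' : ℕ,
      (hc1 : 4 * e - 4 ≤ c) → (hc : c ≤ 4 * e - 1) →
      (hc1' : 4 * e - 4 ≤ c') → (hc' : c' ≤ 4 * e - 1) →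
      M ⟨2 * e - 2, by omega⟩ ⟨c, by omega⟩ * M ⟨2 * e - 1, by omega⟩ ⟨c', by omega⟩
        - M ⟨2 * e - 2, by omega⟩ ⟨c', by omega⟩ * M ⟨2 * e - 1, by omega⟩ ⟨c, by omega⟩
        ∈ I) :
    M.det ∈ I ^ d := by
  have hlt (e : Fin d) : 2 * (e : ℕ) + 1 < N := by omega
  have h := Matrix.det_mem_pow_card_of_minors_mem (I := I) (M := M)
    (p := fun e : Fin d => ⟨2 * e, Nat.lt_of_succ_lt (hlt e)⟩)
    (q := fun e : Fin d => ⟨2 * e + 1, hlt e⟩)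
    (fun a b hab => by simp only [Fin.mk.injEq] at hab; omega)
    (fun a b hab => by simp only [Fin.mk.injEq] at hab; omega)
    (fun a b hab => by simp only [Fin.mk.injEq] at hab; omega) Finset.univ
    fun e _ c c' => ?_
  · simpa using h
  · have hs := hsupp (e + 1) (by omega) (by omega)
    have hm := hminor (e + 1) (by omega) (by omega) c c'
    simp only [show 2 * ((e : ℕ) + 1) - 2 = 2 * e by omega,
      show 2 * ((e : ℕ) + 1) - 1 = 2 * e + 1 by omega] at hs hm
    by_cases hc : (c : ℕ) < 4 * (e + 1) - 4 ∨ 4 * (e + 1) - 1 < (c : ℕ)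
    · simp [hs c hc]
    by_cases hc' : (c' : ℕ) < 4 * (e + 1) - 4 ∨ 4 * (e + 1) - 1 < (c' : ℕ)
    · simp [hs c' hc']
    exact hm (by omega) (by omega) (by omega) (by omega)
end

section
/- Let R be a commutative ring, I ⊆ R an ideal, and d, N natural numbers with 4d ≤ N. For each e ∈ {1, …, d} let α_e, β_e, γ_e, δ_e ∈ R be elements congruent to 1 modulo I. Let M be any N×N matrix over R such that for every e ∈ {1, …, d}, row 2e−1 of M equals (0, …, 0, α_e, β_e, −α_e, −β_e, 0, …, 0) and row 2e of M equals (0, …, 0, 1, γ_e, −δ_e, −1, 0, …, 0), where in both rows the four displayed entries occupy columns 4e−3, 4e−2, 4e−1, 4e and all other entries are 0; the remaining N−2d rows of M are arbitrary. Then det M ∈ I^d (the d-th power of the ideal I). -/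
/-- If the rows of `A` indexed by `S` have all their entries in `I`, then `det A ∈ I ^ #S`. -/
theorem Matrix.det_mem_ideal_pow_card_of_rows_mem {R n : Type*} [CommRing R] [Fintype n]
    [DecidableEq n] (I : Ideal R) (A : Matrix n n R) (S : Finset n)
    (hA : ∀ i ∈ S, ∀ j, A i j ∈ I) : A.det ∈ I ^ S.card := by
  rw [← Matrix.det_transpose, Matrix.det_apply']
  refine Ideal.sum_mem _ fun σ _ => Ideal.mul_mem_left _ _ ?_
  rw [← Finset.prod_mul_prod_compl S, ← Finset.prod_const]
  exact Ideal.mul_mem_right _ _ (Ideal.prod_mem_prod fun i hi => hA i hi (σ i))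

/-- If for each `e ∈ {1, …, d}` the rows `2e-1` and `2e` of `M` (1-indexed) are
`(…, αₑ, βₑ, -αₑ, -βₑ, …)` and `(…, 1, γₑ, -δₑ, -1, …)`, supported on the columns
`{4e-3, …, 4e}`, with `αₑ, βₑ, γₑ, δₑ ≡ 1 (mod I)`, then `det M ∈ I ^ d`. -/
theorem det_mem_ideal_pow_of_double_point_rows
    {R : Type*} [CommRing R] (I : Ideal R) (d N : ℕ) (hdN : 4 * d ≤ N)
    (α β γ δ : ℕ → R)
    (hα : ∀ e : ℕ, (he1 : 1 ≤ e) → (he : e ≤ d) → α e - 1 ∈ I)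
    (hβ : ∀ e : ℕ, (he1 : 1 ≤ e) → (he : e ≤ d) → β e - 1 ∈ I)
    (hγ : ∀ e : ℕ, (he1 : 1 ≤ e) → (he : e ≤ d) → γ e - 1 ∈ I)
    (hδ : ∀ e : ℕ, (he1 : 1 ≤ e) → (he : e ≤ d) → δ e - 1 ∈ I)
    (M : Matrix (Fin N) (Fin N) R)
    (hrow₁ : ∀ e : ℕ, (he1 : 1 ≤ e) → (he : e ≤ d) → ∀ j : Fin N,
      M ⟨2 * e - 2, by omega⟩ j =
        if (j : ℕ) = 4 * e - 4 then α e
        else if (j : ℕ) = 4 * e - 3 then β e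
        else if (j : ℕ) = 4 * e - 2 then -α e
        else if (j : ℕ) = 4 * e - 1 then -β e
        else 0)
    (hrow₂ : ∀ e : ℕ, (he1 : 1 ≤ e) → (he : e ≤ d) → ∀ j : Fin N,
      M ⟨2 * e - 1, by omega⟩ j =
        if (j : ℕ) = 4 * e - 4 then 1
        else if (j : ℕ) = 4 * e - 3 then γ e
        else if (j : ℕ) = 4 * e - 2 then -δ e
        else if (j : ℕ) = 4 * e - 1 then -1
        else 0) :
    M.det ∈ I ^ d := by
  obtain _ | n := N
  · obtain rfl : d = 0 := by omega
    simp
  let c : Fin n → R := fun i => if ∃ e < d, (i : ℕ) = 2 * e then 1 else 0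
  let B : Matrix (Fin (n + 1)) (Fin (n + 1)) R := fun i j =>
    Fin.cases (M 0 j) (fun i => M i.succ j - c i * M i.castSucc j) i
  have hdet : M.det = B.det :=
    Matrix.det_eq_of_forall_row_eq_smul_add_pred c (fun j => rfl)
      (fun i j => (sub_add_cancel (M i.succ j) (c i * M i.castSucc j)).symm)
  let f : Fin d → Fin (n + 1) := fun e => Fin.succ ⟨2 * e, by omega⟩
  have hf : Function.Injective f := fun a b h => by
    have h' : 2 * (a : ℕ) + 1 = 2 * b + 1 := congrArg Fin.val h
    exact Fin.ext (by omega)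
  rw [hdet]
  have hB : ∀ i ∈ Finset.univ.image f, ∀ j, B i j ∈ I := by
    intro i hi j
    obtain ⟨e, -, rfl⟩ := Finset.mem_image.1 hi
    have he : (e : ℕ) + 1 ≤ d := e.2
    have he1 : 1 ≤ (e : ℕ) + 1 := by omega
    have hc : c ⟨2 * e, by omega⟩ = 1 := if_pos ⟨e, e.2, rfl⟩
    have hBe : B (f e) j = M ⟨2 * (e + 1) - 1, by omega⟩ j - M ⟨2 * (e + 1) - 2, by omega⟩ j := by
      change M _ j - c ⟨2 * e, _⟩ * M _ j = _
      rw [hc, one_mul]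
      rfl
    rw [hBe, hrow₁ _ he1 he, hrow₂ _ he1 he]
    have ha := hα _ he1 he
    have hb := hβ _ he1 he
    have hg := hγ _ he1 he
    have hd := hδ _ he1 he
    split_ifs
    · simpa using I.neg_mem ha
    · simpa using I.sub_mem hg hb
    · convert I.sub_mem ha hd using 1
      ring
    · convert hb using 1
      ring
    · simp
  simpa [Finset.card_image_of_injective _ hf] using
    Matrix.det_mem_ideal_pow_card_of_rows_mem I B _ hB
end

section
/- Let h_i, h_j, h_k be real numbers and define g : ℝ → ℝ by g(t) = 4·cosh(t·h_i/2)·sinh(t·h_j/2) − 4·cosh(t·h_k/2)·sinh(t·h_j/2) − 4·sinh(t·(h_k−h_i)/2) + 4·cosh(t·h_k/2)·sinh(t·(−h_i+h_j+h_k)/2) − 4·cosh(t·h_i/2)·sinh(t·(h_i+h_j−h_k)/2) − 2·sinh(t·(h_k−h_i)). Then g(0) = 0, g′(0) = 0, g″(0) = 0, and g‴(0) = 3·(h_k − h_i)·(h_i·h_k + h_j²). -/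
open Real

theorem deriv_sum_mul_sinh {ι : Type*} (s : Finset ι) (c a : ι → ℝ) :
    deriv (fun t : ℝ => ∑ n ∈ s, c n * sinh (t * a n)) =
      fun t => ∑ n ∈ s, c n * a n * cosh (t * a n) := by
  funext t
  refine (HasDerivAt.fun_sum fun n _ => ?_).deriv
  refine ((hasDerivAt_mul_const (a n)).sinh.const_mul (c n)).congr_deriv ?_
  ring

theorem deriv_sum_mul_cosh {ι : Type*} (s : Finset ι) (c a : ι → ℝ) :
    deriv (fun t : ℝ => ∑ n ∈ s, c n * cosh (t * a n)) =
      fun t => ∑ n ∈ s, c n * a n * sinh (t * a n) := by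
  funext t
  refine (HasDerivAt.fun_sum fun n _ => ?_).deriv
  refine ((hasDerivAt_mul_const (a n)).cosh.const_mul (c n)).congr_deriv ?_
  ring

theorem two_mul_cosh_mul_sinh (x y : ℝ) :
    2 * cosh x * sinh y = sinh (y + x) + sinh (y - x) := by
  rw [sinh_add, sinh_sub]
  ring

/-- The combined coefficient function of J. Murakami's third relation, at rescaled
variables `(t·hᵢ, t·hⱼ, t·hₖ)`, vanishes to order 3 at `t = 0`, and its third
derivative at `0` equals `3·(hₖ - hᵢ)·(hᵢ·hₖ + hⱼ²)`. -/
theorem murakami_relation_coefficient_derivatives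
    (hi hj hk : ℝ) (g : ℝ → ℝ)
    (hg : ∀ t : ℝ, g t =
      4 * Real.cosh (t * hi / 2) * Real.sinh (t * hj / 2)
      - 4 * Real.cosh (t * hk / 2) * Real.sinh (t * hj / 2)
      - 4 * Real.sinh (t * (hk - hi) / 2)
      + 4 * Real.cosh (t * hk / 2) * Real.sinh (t * (-hi + hj + hk) / 2)
      - 4 * Real.cosh (t * hi / 2) * Real.sinh (t * (hi + hj - hk) / 2)
      - 2 * Real.sinh (t * (hk - hi))) :
    g 0 = 0 ∧ deriv g 0 = 0 ∧ iteratedDeriv 2 g 0 = 0 ∧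
      iteratedDeriv 3 g 0 = 3 * (hk - hi) * (hi * hk + hj ^ 2) := by
  let c : Fin 8 → ℝ := ![2, 4, -2, -4, -4, 2, -2, -2]
  let a : Fin 8 → ℝ := ![(hi + hj) / 2, (hj - hi) / 2, (hj + hk) / 2, (hj - hk) / 2,
    (hk - hi) / 2, (-hi + hj + 2 * hk) / 2, (2 * hi + hj - hk) / 2, hk - hi]
  have hsum : g = fun t => ∑ n, c n * sinh (t * a n) := by
    funext t
    rw [hg]
    have h₁ := two_mul_cosh_mul_sinh (t * hi / 2) (t * hj / 2)
    have h₂ := two_mul_cosh_mul_sinh (t * hk / 2) (t * hj / 2)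
    have h₃ := two_mul_cosh_mul_sinh (t * hk / 2) (t * (-hi + hj + hk) / 2)
    have h₄ := two_mul_cosh_mul_sinh (t * hi / 2) (t * (hi + hj - hk) / 2)
    simp only [c, a, Fin.sum_univ_eight, Matrix.cons_val]
    ring_nf at h₁ h₂ h₃ h₄ ⊢
    linarith
  have hderiv₁ : deriv g = fun t => ∑ n, c n * a n * cosh (t * a n) := by
    rw [hsum, deriv_sum_mul_sinh]
  have hderiv₂ : iteratedDeriv 2 g = fun t => ∑ n, c n * a n * a n * sinh (t * a n) := by
    rw [iteratedDeriv_succ, iteratedDeriv_one, hderiv₁]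
    exact deriv_sum_mul_cosh _ (fun n => c n * a n) a
  have hderiv₃ : iteratedDeriv 3 g =
      fun t => ∑ n, c n * a n * a n * a n * cosh (t * a n) := by
    rw [iteratedDeriv_succ, hderiv₂]
    exact deriv_sum_mul_sinh _ (fun n => c n * a n * a n) a
  refine ⟨?_, ?_, ?_, ?_⟩
  · simp [hsum]
  · simp only [hderiv₁, c, a, Fin.sum_univ_eight, Matrix.cons_val, zero_mul, cosh_zero]
    ring
  · simp [hderiv₂]
  · simp only [hderiv₃, c, a, Fin.sum_univ_eight, Matrix.cons_val, zero_mul, cosh_zero]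
    ring
end
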